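/- arXiv:1408.3765 — 4 statements merged into one kernel-verified Lean document; each statement's English description precedes it below -/
import Mathlib

section
/- For every integer N ≥ 1 and all integers a and b, f_N(a) · f_N(b) ≤ f_N(a+b). (This is the key submultiplicativity inequality; taking a = m−i, b = j−m it yields √(p_max(i,m))·√(p_max(m,j)) ≤ √(p_max(i,j)), i.e. the triangle inequality d_N(i,j) ≤ d_N(i,m) + d_N(m,j) for the information-transfer-infidelity prametric of the uniform spin ring.) -/
open Real Finset

/-- `f N d = (1/N) ∑_{k=0}^{N-1} |cos(2π k d / N)|`, the square root of the
information transfer fidelity `p_max` of the uniform XX spin ring of size `N`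
between nodes whose index difference is `d`. -/
noncomputable def ringITF (N : ℕ) (d : ℤ) : ℝ :=
  (1 / N) * ∑ k ∈ Finset.range N, |Real.cos (2 * π * k * d / N)|

theorem sum_cos_eq_zero_of_not_dvd {N : ℕ} (hN : N ≠ 0) {m : ℤ} (hm : ¬ (N : ℤ) ∣ m) :
    ∑ k ∈ Finset.range N, Real.cos (2 * π * k * m / N) = 0 := by
  have hN' : (N : ℂ) ≠ 0 := Nat.cast_ne_zero.mpr hN
  set z : ℂ := Complex.exp (2 * π * m / N * Complex.I) with hz
  have hz1 : z - 1 ≠ 0 := by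
    rw [sub_ne_zero]
    intro h
    obtain ⟨n, hn⟩ := Complex.exp_eq_one_iff.mp h
    refine hm ⟨n, ?_⟩
    have h2 : (2 * π * Complex.I) ≠ 0 := Complex.two_pi_I_ne_zero
    have h3 : (2 * π * Complex.I) * m = (2 * π * Complex.I) * (N * n) := by
      field_simp at hn ⊢
      linear_combination hn
    exact_mod_cast mul_left_cancel₀ h2 h3
  have hzN : z ^ N = 1 := by
    rw [hz, ← Complex.exp_nat_mul, Complex.exp_eq_one_iff]
    exact ⟨m, by field_simp⟩
  have hsum : ∑ k ∈ Finset.range N, z ^ k = 0 := by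
    have h := mul_geom_sum z N
    rw [hzN, sub_self] at h
    exact (mul_eq_zero.mp h).resolve_left hz1
  have hre := congrArg Complex.re hsum
  rw [Complex.re_sum, Complex.zero_re] at hre
  rw [← hre]
  refine Finset.sum_congr rfl fun k _ => ?_
  rw [hz, ← Complex.exp_nat_mul, ← Complex.exp_ofReal_mul_I_re]
  congr 2
  push_cast
  ring

theorem sum_cos_eq_card_of_dvd (N : ℕ) {m : ℤ} (hm : (N : ℤ) ∣ m) :
    ∑ k ∈ Finset.range N, Real.cos (2 * π * k * m / N) = N := by
  rcases eq_or_ne N 0 with rfl | hN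
  · simp
  obtain ⟨q, rfl⟩ := hm
  have hN' : (N : ℝ) ≠ 0 := Nat.cast_ne_zero.mpr hN
  have h (k : ℕ) : Real.cos (2 * π * k * ((N * q : ℤ) : ℝ) / N) = 1 := by
    rw [← Real.cos_int_mul_two_pi (k * q)]
    congr 1
    push_cast
    field_simp
  rw [Finset.sum_congr rfl fun k _ => h k]
  simp

theorem sum_cos_sq (N : ℕ) (d : ℤ) :
    ∑ k ∈ Finset.range N, Real.cos (2 * π * k * d / N) ^ 2 =
      N / 2 + (∑ k ∈ Finset.range N, Real.cos (2 * π * k * (2 * d : ℤ) / N)) / 2 := by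
  have h (k : ℕ) : Real.cos (2 * π * k * d / N) ^ 2 =
      1 / 2 + Real.cos (2 * π * k * (2 * d : ℤ) / N) / 2 := by
    rw [Real.cos_sq]
    congr 3
    push_cast
    ring
  simp only [h, Finset.sum_add_distrib, ← Finset.sum_div]
  simp

theorem ringITF_nonneg (N : ℕ) (d : ℤ) : 0 ≤ ringITF N d := by
  unfold ringITF
  positivity

theorem ringITF_le_one (N : ℕ) (d : ℤ) : ringITF N d ≤ 1 := by
  have h : ∑ k ∈ Finset.range N, |Real.cos (2 * π * k * d / N)| ≤ N := by
    simpa using Finset.sum_le_card_nsmul (Finset.range N) _ 1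
      fun k _ => Real.abs_cos_le_one (2 * π * k * d / N)
  rw [ringITF, one_div_mul_eq_div]
  exact div_le_one_of_le₀ h (Nat.cast_nonneg N)

theorem half_le_ringITF {N : ℕ} (hN : N ≠ 0) (d : ℤ) : 1 / 2 ≤ ringITF N d := by
  have hpos : (0 : ℝ) < N := by positivity
  have hle : ∑ k ∈ Finset.range N, Real.cos (2 * π * k * d / N) ^ 2 ≤
      ∑ k ∈ Finset.range N, |Real.cos (2 * π * k * d / N)| := by
    refine Finset.sum_le_sum fun k _ => ?_
    rw [← sq_abs]
    exact pow_le_of_le_one (abs_nonneg _) (Real.abs_cos_le_one _) two_ne_zero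
  have hnonneg : 0 ≤ ∑ k ∈ Finset.range N, Real.cos (2 * π * k * (2 * d : ℤ) / N) := by
    by_cases hd : (N : ℤ) ∣ 2 * d
    · rw [sum_cos_eq_card_of_dvd N hd]
      exact hpos.le
    · rw [sum_cos_eq_zero_of_not_dvd hN hd]
  rw [sum_cos_sq] at hle
  rw [ringITF, one_div_mul_eq_div, le_div_iff₀ hpos]
  linarith

theorem ringITF_sq_le_half {N : ℕ} (hN : N ≠ 0) {d : ℤ} (hd : ¬ (N : ℤ) ∣ 2 * d) :
    ringITF N d ^ 2 ≤ 1 / 2 := by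
  have hpos : (0 : ℝ) < N := by positivity
  have h := sq_sum_le_card_mul_sum_sq (s := Finset.range N)
    (f := fun k : ℕ => |Real.cos (2 * π * k * d / N)|)
  simp only [sq_abs, Finset.card_range, sum_cos_sq, sum_cos_eq_zero_of_not_dvd hN hd] at h
  rw [ringITF, one_div_mul_eq_div, div_pow, div_le_iff₀ (by positivity)]
  linarith

theorem ringITF_add_of_dvd (N : ℕ) {a : ℤ} (ha : (N : ℤ) ∣ 2 * a) (b : ℤ) :
    ringITF N (a + b) = ringITF N b := by
  rcases eq_or_ne N 0 with rfl | hN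
  · simp [ringITF]
  obtain ⟨q, hq⟩ := ha
  have hN' : (N : ℝ) ≠ 0 := Nat.cast_ne_zero.mpr hN
  have hq' : (2 : ℝ) * a = N * q := by exact_mod_cast hq
  unfold ringITF
  congr 1
  refine Finset.sum_congr rfl fun k _ => ?_
  have h : 2 * π * k * ((a + b : ℤ) : ℝ) / N = 2 * π * k * b / N + (k * q : ℤ) * π := by
    push_cast
    field_simp
    linear_combination (k : ℝ) * hq'
  rw [h, Real.cos_add_int_mul_pi, abs_mul, abs_neg_one_zpow, one_mul]

/-- Submultiplicativity of `f_N`: `f_N(a) · f_N(b) ≤ f_N(a+b)`, which yields the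
triangle inequality for the information-transfer-infidelity prametric
`d_N(i,j) = -2 log f_N(i-j)` of the uniform spin ring. -/
theorem ringITF_mul_le (N : ℕ) (hN : 1 ≤ N) (a b : ℤ) :
    ringITF N a * ringITF N b ≤ ringITF N (a + b) := by
  have hN0 : N ≠ 0 := Nat.one_le_iff_ne_zero.mp hN
  by_cases ha : (N : ℤ) ∣ 2 * a
  · rw [ringITF_add_of_dvd N ha]
    exact mul_le_of_le_one_left (ringITF_nonneg N b) (ringITF_le_one N a)
  by_cases hb : (N : ℤ) ∣ 2 * b
  · rw [add_comm a b, ringITF_add_of_dvd N hb]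
    exact mul_le_of_le_one_right (ringITF_nonneg N a) (ringITF_le_one N b)
  linarith [two_mul_le_add_sq (ringITF N a) (ringITF N b), ringITF_sq_le_half hN0 ha,
    ringITF_sq_le_half hN0 hb, half_le_ringITF hN0 (a + b)]
end

section
/- For every integer N ≥ 1 and every integer d: 0 ≤ f_N(d) ≤ 1 and f_N(0) = 1; moreover, if N is odd then f_N(d) = 1 if and only if N divides d, and if N is even then f_N(d) = 1 if and only if N/2 divides d. (Hence d_N = −2 log f_N is a metric on the vertices of an odd ring, and a pseudo-metric on an even ring that becomes a metric after identifying antipodal nodes.) -/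
open Real Finset

theorem ringITF_eq_one_iff_forall {N : ℕ} (hN : 1 ≤ N) (d : ℤ) :
    ringITF N d = 1 ↔ ∀ k ∈ Finset.range N, |Real.cos (2 * π * k * d / N)| = 1 := by
  have hN' : (N : ℝ) ≠ 0 := by positivity
  rw [← Finset.sum_eq_sum_iff_of_le fun k _ => Real.abs_cos_le_one _, ringITF,
    one_div_mul_eq_div, div_eq_one_iff_eq hN']
  simp

theorem ringITF_eq_one_iff_dvd_two_mul {N : ℕ} (hN : 1 ≤ N) (d : ℤ) :
    ringITF N d = 1 ↔ (N : ℤ) ∣ 2 * d := by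
  have hN' : (N : ℝ) ≠ 0 := by positivity
  rw [ringITF_eq_one_iff_forall hN]
  constructor
  · intro h
    obtain rfl | hN1 := hN.eq_or_lt
    · simp
    have h1 := h 1 (Finset.mem_range.2 hN1)
    rw [Real.abs_cos_eq_one_iff] at h1
    obtain ⟨n, hn⟩ := h1
    refine ⟨n, ?_⟩
    field_simp at hn
    push_cast at hn
    have : (2 * d : ℝ) = N * n := by linarith
    exact_mod_cast this
  · rintro ⟨n, hn⟩ k -
    have hn' : (2 * d : ℝ) = N * n := by exact_mod_cast hn
    rw [Real.abs_cos_eq_one_iff]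
    refine ⟨k * n, ?_⟩
    push_cast
    rw [eq_div_iff hN']
    linear_combination -π * k * hn'

/-- `0 ≤ f_N(d) ≤ 1`, `f_N(0) = 1`; if `N` is odd then `f_N(d) = 1` iff `N ∣ d`,
and if `N` is even then `f_N(d) = 1` iff `N/2 ∣ d`.  Hence `d_N = -2 log f_N` is a
metric on the vertices of an odd ring and a pseudo-metric on an even ring that
becomes a metric after antipodal identification. -/
theorem ringITF_bounds_and_eq_one_iff (N : ℕ) (hN : 1 ≤ N) (d : ℤ) :
    (0 ≤ ringITF N d ∧ ringITF N d ≤ 1) ∧ ringITF N 0 = 1 ∧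
    (Odd N → (ringITF N d = 1 ↔ (N : ℤ) ∣ d)) ∧
    (Even N → (ringITF N d = 1 ↔ ((N : ℤ) / 2) ∣ d)) := by
  refine ⟨⟨ringITF_nonneg N d, ringITF_le_one N d⟩,
    (ringITF_eq_one_iff_dvd_two_mul hN 0).2 (by simp), fun hodd => ?_, ?_⟩
  · rw [ringITF_eq_one_iff_dvd_two_mul hN]
    have hco : IsCoprime (N : ℤ) 2 := by exact_mod_cast hodd.coprime_two_right
    exact ⟨hco.dvd_of_dvd_mul_left, fun h => h.mul_left 2⟩
  · rintro ⟨m, rfl⟩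
    rw [ringITF_eq_one_iff_dvd_two_mul hN]
    have hm : ((m + m : ℕ) : ℤ) = 2 * m := by push_cast; ring
    rw [hm, mul_dvd_mul_iff_left two_ne_zero, Int.mul_ediv_cancel_left _ two_ne_zero]
end

section
/- Let p be a prime and d an integer not divisible by p. Then f_p(d) = f_p(1); and if moreover p is odd, then also f_{2p}(d) = f_{2p}(1). (Thus for rings of size N = p or N = 2p with p prime, the information-transfer-infidelity distances between distinct equivalence classes of nodes are all equal.) -/
open Real Finset

theorem ZMod.sum_range_natCast {M : Type*} [AddCommMonoid M] (n : ℕ) [NeZero n]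
    (f : ZMod n → M) : ∑ k ∈ Finset.range n, f k = ∑ x, f x := by
  refine Finset.sum_nbij' (fun k : ℕ => (k : ZMod n)) ZMod.val ?_ ?_ ?_ ?_ ?_
  · simp
  · intro x _
    exact Finset.mem_range.2 x.val_lt
  · intro k hk
    exact ZMod.val_cast_of_lt (Finset.mem_range.1 hk)
  · intro x _
    exact ZMod.natCast_rightInverse x
  · simp

/-- The sum of a `p`-periodic function over the residues is unchanged when they are dilated by an
integer prime to `p`. -/
theorem Function.Periodic.sum_range_mul_int {M : Type*} [AddCommMonoid M] {p : ℕ}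
    (hp : p.Prime) {h : ℤ → M} (hh : Function.Periodic h (p : ℤ)) {d : ℤ}
    (hd : ¬ (p : ℤ) ∣ d) :
    ∑ k ∈ Finset.range p, h (k * d) = ∑ k ∈ Finset.range p, h k := by
  have := Fact.mk hp
  have lift (m : ℤ) : h m = h ((m : ZMod p).cast : ℤ) := by
    rw [ZMod.coe_intCast, Int.emod_def, mul_comm]
    exact (hh.sub_int_mul_eq (m / p)).symm
  have hd' : (d : ZMod p) ≠ 0 := by rwa [Ne, ZMod.intCast_zmod_eq_zero_iff_dvd]
  calc ∑ k ∈ Finset.range p, h (k * d)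
      = ∑ k ∈ Finset.range p, h (((k : ZMod p) * (d : ZMod p)).cast : ℤ) :=
        Finset.sum_congr rfl fun k _ => by rw [lift]; push_cast; rfl
    _ = ∑ x : ZMod p, h ((x * (d : ZMod p)).cast : ℤ) :=
        ZMod.sum_range_natCast p fun x => h ((x * (d : ZMod p)).cast : ℤ)
    _ = ∑ x : ZMod p, h (x.cast : ℤ) :=
        Equiv.sum_comp (Equiv.mulRight₀ (d : ZMod p) hd') fun x : ZMod p => h (x.cast : ℤ)
    _ = ∑ k ∈ Finset.range p, h ((k : ZMod p).cast : ℤ) :=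
        (ZMod.sum_range_natCast p fun x => h (x.cast : ℤ)).symm
    _ = ∑ k ∈ Finset.range p, h k :=
        Finset.sum_congr rfl fun k _ => by rw [lift k]; push_cast; rfl

theorem periodic_abs_cos_two_pi_mul_div {N : ℕ} (hN : N ≠ 0) :
    Function.Periodic (fun m : ℤ => |Real.cos (2 * π * m / N)|) (N : ℤ) := by
  intro m
  have hN' : (N : ℝ) ≠ 0 := Nat.cast_ne_zero.2 hN
  have : 2 * π * ((m + (N : ℤ) : ℤ) : ℝ) / N = 2 * π * m / N + 2 * π := by
    push_cast
    field_simp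
  simp only [this, Real.cos_add_two_pi]

theorem periodic_abs_cos_two_pi_mul_div_two_mul {n : ℕ} (hn : n ≠ 0) :
    Function.Periodic (fun m : ℤ => |Real.cos (2 * π * m / (2 * n : ℕ))|) (n : ℤ) := by
  intro m
  have hn' : (n : ℝ) ≠ 0 := Nat.cast_ne_zero.2 hn
  have : 2 * π * ((m + (n : ℤ) : ℤ) : ℝ) / (2 * n : ℕ) = 2 * π * m / (2 * n : ℕ) + π := by
    push_cast
    field_simp
  simp only [this, Real.cos_add_pi, abs_neg]

theorem ringITF_eq_sum_int (N : ℕ) (d : ℤ) :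
    ringITF N d = (1 / N) *
      ∑ k ∈ Finset.range N, (fun m : ℤ => |Real.cos (2 * π * m / N)|) (k * d) := by
  simp only [ringITF]
  push_cast
  simp only [mul_assoc]

/-- Over two periods, a dilated sum of a periodic function is twice the sum over one. -/
theorem Function.Periodic.sum_range_two_mul_int {M : Type*} [AddCommMonoid M] {n : ℕ}
    {h : ℤ → M} (hh : Function.Periodic h (n : ℤ)) (d : ℤ) :
    ∑ k ∈ Finset.range (2 * n), h (k * d) = 2 • ∑ k ∈ Finset.range n, h (k * d) := by
  rw [two_mul, Finset.sum_range_add, two_nsmul]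
  congr 1
  refine Finset.sum_congr rfl fun k _ => ?_
  have : ((n + k : ℕ) : ℤ) * d = k * d + d * n := by push_cast; ring
  rw [this]
  exact hh.int_mul d _

/-- For a prime `p` and `d` not divisible by `p`, `f_p(d) = f_p(1)`; if moreover
`p` is odd then also `f_{2p}(d) = f_{2p}(1)`.  Thus for rings of size `p` or `2p`
the information-transfer-infidelity distances between distinct equivalence
classes of nodes are all equal. -/
theorem ringITF_uniform_of_prime (p : ℕ) (hp : p.Prime) (d : ℤ)
    (hd : ¬ (p : ℤ) ∣ d) :
    ringITF p d = ringITF p 1 ∧ (Odd p → ringITF (2 * p) d = ringITF (2 * p) 1) := by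
  have h1 : ¬ (p : ℤ) ∣ 1 := fun h =>
    hp.one_lt.ne' (by exact_mod_cast Int.eq_one_of_dvd_one (by positivity) h)
  refine ⟨?_, fun _ => ?_⟩
  · have hper := periodic_abs_cos_two_pi_mul_div hp.ne_zero
    rw [ringITF_eq_sum_int, ringITF_eq_sum_int, hper.sum_range_mul_int hp hd,
      hper.sum_range_mul_int hp h1]
  · have hper := periodic_abs_cos_two_pi_mul_div_two_mul hp.ne_zero
    rw [ringITF_eq_sum_int, ringITF_eq_sum_int, hper.sum_range_two_mul_int,
      hper.sum_range_two_mul_int, hper.sum_range_mul_int hp hd, hper.sum_range_mul_int hp h1]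
end

section
/- Let n ≥ 1, let θ : Fin n → ℝ be such that θ i₀ is irrational for at least one index i₀, and let x : Fin n → ℝ satisfy x i > 0 for all i. For s > 0, p : Fin n → ℤ and q ∈ ℤ set F_s(p,q) = ∑_i (x i)² · (p i − θ i · q)² + s² q². Suppose p̂ and q̂ are functions on (0,∞) such that for every s > 0 one has q̂(s) ∈ ℤ with q̂(s) ≥ 1 and F_s(p̂(s), q̂(s)) ≤ F_s(p,q) for every p : Fin n → ℤ and every integer q ≥ 1 (i.e., (p̂(s), q̂(s)) is a minimizer of the weighted-LLL objective). Then q̂(s) → +∞ as s → 0⁺. -/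
open Filter

/-- The weighted-LLL objective `F_s(p,q) = ∑ i (x i)² (p i − θ i q)² + s² q²`. -/
noncomputable def lllObjective {n : ℕ} (θ x : Fin n → ℝ) (s : ℝ)
    (p : Fin n → ℤ) (q : ℤ) : ℝ :=
  ∑ i, (x i) ^ 2 * ((p i : ℝ) - θ i * (q : ℝ)) ^ 2 + s ^ 2 * (q : ℝ) ^ 2

/-- Qualitative simultaneous Dirichlet approximation: finitely many reals have arbitrarily good
simultaneous rational approximations with a common positive denominator. -/
theorem exists_simultaneous_approximation {ι : Type*} [Fintype ι] (θ : ι → ℝ) {ε : ℝ}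
    (hε : 0 < ε) :
    ∃ (p : ι → ℤ) (q : ℤ), 1 ≤ q ∧ ∀ i, |(p i : ℝ) - θ i * q| < ε := by
  have hcpt : IsCompact (Set.Icc (0 : ι → ℝ) 1) := isCompact_Icc
  obtain ⟨a, -, φ, hφ, hlim⟩ := hcpt.tendsto_subseq
    (x := fun (k : ℕ) i => Int.fract (θ i * k))
    (fun k => ⟨fun i => Int.fract_nonneg _, fun i => (Int.fract_lt_one _).le⟩)
  obtain ⟨N, hN⟩ := Metric.cauchySeq_iff.1 hlim.cauchySeq ε hε
  have hd := hN (N + 1) (Nat.le_succ N) N le_rfl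
  have hlt : φ N < φ (N + 1) := hφ (Nat.lt_succ_self N)
  refine ⟨fun i => ⌊θ i * φ (N + 1)⌋ - ⌊θ i * φ N⌋, (φ (N + 1) : ℤ) - φ N, by omega, fun i => ?_⟩
  have hi := (dist_le_pi_dist _ _ i).trans_lt hd
  rw [Real.dist_eq, abs_sub_comm] at hi
  simp only [Function.comp_apply, Int.fract] at hi
  refine lt_of_eq_of_lt (congrArg _ ?_) hi
  push_cast
  ring

/-- The approximation part of the LLL objective can be made arbitrarily small. -/
theorem exists_weighted_error_lt {ι : Type*} [Fintype ι] (θ x : ι → ℝ) {c : ℝ} (hc : 0 < c) :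
    ∃ (p : ι → ℤ) (q : ℤ), 1 ≤ q ∧ ∑ i, (x i) ^ 2 * ((p i : ℝ) - θ i * q) ^ 2 < c := by
  have hW : 0 ≤ ∑ i, (x i) ^ 2 := Finset.sum_nonneg fun i _ => sq_nonneg _
  have hε : 0 < c / (∑ i, (x i) ^ 2 + 1) := by positivity
  obtain ⟨p, q, hq, hp⟩ := exists_simultaneous_approximation θ (Real.sqrt_pos.2 hε)
  refine ⟨p, q, hq, ?_⟩
  calc ∑ i, (x i) ^ 2 * ((p i : ℝ) - θ i * q) ^ 2
      ≤ ∑ i, (x i) ^ 2 * (c / (∑ i, (x i) ^ 2 + 1)) := by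
        refine Finset.sum_le_sum fun i _ => mul_le_mul_of_nonneg_left ?_ (sq_nonneg _)
        rw [← sq_abs, ← Real.sq_sqrt hε.le]
        exact pow_le_pow_left₀ (abs_nonneg _) (hp i).le 2
    _ = (∑ i, (x i) ^ 2) * (c / (∑ i, (x i) ^ 2 + 1)) := by rw [Finset.sum_mul]
    _ < (∑ i, (x i) ^ 2 + 1) * (c / (∑ i, (x i) ^ 2 + 1)) :=
        mul_lt_mul_of_pos_right (lt_add_one _) hε
    _ = c := mul_div_cancel₀ c (by positivity)

/-- If `θ i₀` is irrational and `x i₀` is nonzero, the LLL objective at a fixed nonzero denominator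
is bounded below by a positive constant, uniformly in the numerators and in `s`. -/
theorem exists_pos_le_lllObjective {n : ℕ} {θ x : Fin n → ℝ} {i₀ : Fin n}
    (hθ : Irrational (θ i₀)) (hx : x i₀ ≠ 0) {q : ℤ} (hq : q ≠ 0) :
    ∃ c : ℝ, 0 < c ∧ ∀ s p, c ≤ lllObjective θ x s p q := by
  have hne : θ i₀ * q - round (θ i₀ * q) ≠ 0 :=
    sub_ne_zero.2 ((hθ.mul_intCast hq).ne_int _)
  refine ⟨(x i₀) ^ 2 * (θ i₀ * q - round (θ i₀ * q)) ^ 2, by positivity, fun s p => ?_⟩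
  have hround : (θ i₀ * q - round (θ i₀ * q)) ^ 2 ≤ ((p i₀ : ℝ) - θ i₀ * q) ^ 2 := by
    rw [sq_le_sq, abs_sub_comm (p i₀ : ℝ)]
    exact round_le _ _
  have hterm := Finset.single_le_sum
    (f := fun i => (x i) ^ 2 * ((p i : ℝ) - θ i * q) ^ 2)
    (fun i _ => by positivity) (Finset.mem_univ i₀)
  calc _ ≤ (x i₀) ^ 2 * ((p i₀ : ℝ) - θ i₀ * q) ^ 2 :=
        mul_le_mul_of_nonneg_left hround (sq_nonneg _)
    _ ≤ _ := hterm
    _ ≤ lllObjective θ x s p q := le_add_of_nonneg_right (by positivity)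

/-- If `θ` has at least one irrational component, the weights `x i` are positive,
and `(p̂ s, q̂ s)` minimizes the weighted-LLL objective `F_s` over all integer
vectors `p` and integers `q ≥ 1` for each `s > 0`, then the optimal denominators
`q̂ s` tend to `+∞` as `s → 0⁺`. -/
theorem lll_denominator_tendsto_atTop {n : ℕ} (hn : 1 ≤ n)
    (θ : Fin n → ℝ) (i₀ : Fin n) (hθ : Irrational (θ i₀))
    (x : Fin n → ℝ) (hx : ∀ i, 0 < x i)
    (phat : ℝ → Fin n → ℤ) (qhat : ℝ → ℤ)
    (hq : ∀ s : ℝ, 0 < s → 1 ≤ qhat s)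
    (hmin : ∀ s : ℝ, 0 < s → ∀ (p : Fin n → ℤ) (q : ℤ), 1 ≤ q →
      lllObjective θ x s (phat s) (qhat s) ≤ lllObjective θ x s p q) :
    Tendsto qhat (nhdsWithin 0 (Set.Ioi 0)) atTop := by
  have hne : ∀ q : ℤ, 1 ≤ q → ∀ᶠ s in nhdsWithin (0 : ℝ) (Set.Ioi 0), qhat s ≠ q := by
    intro q hq1
    obtain ⟨c, hc, hlow⟩ := exists_pos_le_lllObjective hθ (hx i₀).ne' (show q ≠ 0 by omega)
    obtain ⟨p', q', hq', hlt⟩ := exists_weighted_error_lt θ x hc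
    have hcont : Continuous fun s => lllObjective θ x s p' q' := by
      unfold lllObjective
      fun_prop
    have hsmall : ∀ᶠ s in nhds (0 : ℝ), lllObjective θ x s p' q' < c :=
      hcont.continuousAt.eventually_lt_const (by simpa [lllObjective] using hlt)
    filter_upwards [hsmall.filter_mono nhdsWithin_le_nhds, self_mem_nhdsWithin] with s hs hpos heq
    have hle := hmin s hpos p' q' hq'
    rw [heq] at hle
    exact absurd ((hlow s (phat s)).trans hle) hs.not_ge
  refine tendsto_atTop.2 fun b => ?_
  have hall : ∀ᶠ s in nhdsWithin (0 : ℝ) (Set.Ioi 0), ∀ q ∈ Set.Icc 1 b, qhat s ≠ q :=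
    (eventually_all_finite (Set.finite_Icc 1 b)).2 fun q hqb => hne q hqb.1
  filter_upwards [hall, self_mem_nhdsWithin] with s hs hpos
  by_contra! hlt
  exact hs (qhat s) ⟨hq s hpos, hlt.le⟩ rfl
end
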